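/- Let L be a binary relational language. Every finite L-structure is 2-isomorphic to a finite transitive L-structure. -/

import Mathlib

namespace AN

/-- Formulas of first-order logic over a binary relational language `L`
(a type whose elements are the binary relation symbols; there are no
function or constant symbols) with variables from `V`. -/
inductive FOV (L : Type) (V : Type) : Type
  | eq : V → V → FOV L V
  | rel : L → V → V → FOV L V
  | not : FOV L V → FOV L V
  | and : FOV L V → FOV L V → FOV L V
  | ex : V → FOV L V → FOV L V

/-- An `L`-structure on universe `M`: an interpretation of each binary
relation symbol as a binary relation on `M`. -/
abbrev Str (L M : Type) := L → M → M → Prop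

/-- Satisfaction of a formula in a structure under a valuation of the variables. -/
def Sat {L V M : Type} [DecidableEq V] (S : Str L M) : FOV L V → (V → M) → Prop
  | .eq i j, v => v i = v j
  | .rel r i j, v => S r (v i) (v j)
  | .not φ, v => ¬ Sat S φ v
  | .and φ ψ, v => Sat S φ v ∧ Sat S ψ v
  | .ex i φ, v => ∃ m : M, Sat S φ (Function.update v i m)

/-- The free variables of a formula. -/
def Free {L V : Type} : FOV L V → Set V
  | .eq i j => {i, j}
  | .rel _ i j => {i, j}
  | .not φ => Free φ
  | .and φ ψ => Free φ ∪ Free ψ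
  | .ex i φ => Free φ \ {i}

/-- A sentence is a formula with no free variables. -/
def Sentence {L V : Type} (φ : FOV L V) : Prop := Free φ = ∅

/-- The two-variable fragment FO2(L): formulas built from the two variables x, y. -/
abbrev FO2 (L : Type) := FOV L (Fin 2)

/-- The three-variable fragment FO3(L): formulas built from the three variables x, y, z. -/
abbrev FO3 (L : Type) := FOV L (Fin 3)

/-- `M ⊨ φ[a,b]` : the FO2-formula φ holds with x interpreted as a and y as b. -/
def Sat2 {L M : Type} (S : Str L M) (φ : FO2 L) (a b : M) : Prop :=
  Sat S φ ![a, b]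

/-- The 2-type of the pair (a,b) in the structure: all FO2-formulas true of (a,b). -/
def Type2 {L M : Type} (S : Str L M) (a b : M) : Set (FO2 L) :=
  {φ | Sat2 S φ a b}

/-- `f` is an automorphism of the structure `S`. -/
def IsAuto {L M : Type} (S : Str L M) (f : M ≃ M) : Prop :=
  ∀ r a b, S r a b ↔ S r (f a) (f b)

/-- A structure is transitive if any two elements of the same type are
connected by an automorphism. -/
def IsTransitive {L M : Type} (S : Str L M) : Prop :=
  ∀ a b : M, Type2 S a a = Type2 S b b →
    ∃ f : M ≃ M, IsAuto S f ∧ f a = b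

/-- A structure is 2-homogeneous if whenever a and b have the same type,
every c can be matched by some d with Type(a,c) = Type(b,d). -/
def IsHomog2 {L M : Type} (S : Str L M) : Prop :=
  ∀ a b c : M, Type2 S a a = Type2 S b b →
    ∃ d : M, Type2 S a c = Type2 S b d

/-- A 2-partial isomorphism between `S` and `T`, presented by its part `i1`
relating elements and its part `i2` relating pairs. -/
structure IsTwoIso {L M N : Type} (S : Str L M) (T : Str L N)
    (i1 : M → N → Prop) (i2 : M → M → N → N → Prop) : Prop where
  eq_iff : ∀ a b a' b', i2 a b a' b' → (a = b ↔ a' = b')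
  rel_iff2 : ∀ a b a' b', i2 a b a' b' → ∀ r,
      (S r a a ↔ T r a' a') ∧ (S r a b ↔ T r a' b') ∧
      (S r b a ↔ T r b' a') ∧ (S r b b ↔ T r b' b')
  rel_iff1 : ∀ a a', i1 a a' → ∀ r, S r a a ↔ T r a' a'
  restrict : ∀ a b a' b', i2 a b a' b' → i1 a a' ∧ i1 b b'
  forth1 : ∀ a, ∃ a', i1 a a'
  back1 : ∀ a', ∃ a, i1 a a'
  forth2 : ∀ a a', i1 a a' → ∀ b, ∃ b', i2 a b a' b'
  back2 : ∀ a a', i1 a a' → ∀ b', ∃ b, i2 a b a' b'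

/-- Two structures are 2-isomorphic when some 2-partial isomorphism between
them exists. -/
def TwoIsomorphic {L M N : Type} (S : Str L M) (T : Str L N) : Prop :=
  ∃ i1 i2, IsTwoIso S T i1 i2

/-- 2-equivalence: the same FO2 sentences hold in both structures. -/
def Equiv2 {L M N : Type} (S : Str L M) (T : Str L N) : Prop :=
  ∀ φ : FO2 L, Sentence φ → ((∀ v, Sat S φ v) ↔ (∀ v, Sat T φ v))

/-- 3-equivalence: the same FO3 sentences hold in both structures. -/
def Equiv3 {L M N : Type} (S : Str L M) (T : Str L N) : Prop :=
  ∀ φ : FO3 L, Sentence φ → ((∀ v, Sat S φ v) ↔ (∀ v, Sat T φ v))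

/-- Expansion of an `L`-structure by one new binary relation `R`; the new
relation symbol is `Sum.inr ()`, so the expanded language is `L ⊕ Unit`. -/
def expand {L M : Type} (S : Str L M) (R : M → M → Prop) : Str (L ⊕ Unit) M :=
  Sum.elim S (fun _ => R)

/-- `S` is a model of the set `Th` of sentences. -/
def ModelsSet {L V M : Type} [DecidableEq V] (S : Str L M) (Th : Set (FOV L V)) : Prop :=
  ∀ φ ∈ Th, ∀ v : V → M, Sat S φ v

/-- `Sg` is a weak implicit definition of the new relation symbol w.r.t. `Th`:
in each model of `Th` there is at most one relation satisfying `Sg`. -/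
def WeakImplicitDef (L : Type) (Th : Set (FO2 L)) (Sg : Set (FO2 (L ⊕ Unit))) : Prop :=
  ∀ (M : Type) (S : Str L M), Nonempty M → ModelsSet S Th →
    ∀ R R' : M → M → Prop,
      ModelsSet (expand S R) Sg → ModelsSet (expand S R') Sg → R = R'

/-- `Sg` is a strong implicit definition of the new relation symbol w.r.t. `Th`:
in each model of `Th` there is exactly one relation satisfying `Sg`. -/
def StrongImplicitDef (L : Type) (Th : Set (FO2 L)) (Sg : Set (FO2 (L ⊕ Unit))) : Prop :=
  ∀ (M : Type) (S : Str L M), Nonempty M → ModelsSet S Th →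
    ∃! R : M → M → Prop, ModelsSet (expand S R) Sg

/-- `Sg` can be made explicit w.r.t. `Th`: there is an FO2(L)-formula φ(x,y)
with Th ∪ Sg ⊨ ∀x∀y (R(x,y) ↔ φ(x,y)). -/
def MadeExplicit (L : Type) (Th : Set (FO2 L)) (Sg : Set (FO2 (L ⊕ Unit))) : Prop :=
  ∃ φ : FO2 L, ∀ (M : Type) (S : Str L M), Nonempty M → ModelsSet S Th →
    ∀ R : M → M → Prop, ModelsSet (expand S R) Sg →
      ∀ a b : M, R a b ↔ Sat2 S φ a b

/-- `R` does not cut 2-types in `S`. -/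
def NoCut {L M : Type} (S : Str L M) (R : M → M → Prop) : Prop :=
  ∀ a b c d : M, Type2 S a b = Type2 S c d → (R a b ↔ R c d)

/-- The valuation sending the variable `0` (i.e. x) to `m` and the variables
`1,…,k` (the constants naming the tuple `t`) to the entries of `t`. -/
def valCons {M : Type} (m : M) {k : ℕ} (t : Fin k → M) : ℕ → M :=
  fun i => if h : 0 < i ∧ i - 1 < k then t ⟨i - 1, h.2⟩ else m

/-- ω-saturation, phrased with formulas whose free variables are among
x = variable 0 and the constants = variables 1,…,k naming a finite tuple t:
if every finite subset of Γ(x) is satisfiable in (M,t), then Γ(x) is realized. -/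
def OmegaSaturated {L M : Type} (S : Str L M) : Prop :=
  ∀ (k : ℕ) (t : Fin k → M) (Γ : Set (FOV L ℕ)),
    (∀ φ ∈ Γ, Free φ ⊆ {i | i ≤ k}) →
    (∀ Γ₀ : Finset (FOV L ℕ), ↑Γ₀ ⊆ Γ →
        ∃ m : M, ∀ φ ∈ Γ₀, Sat S φ (valCons m t)) →
    ∃ m : M, ∀ φ ∈ Γ, Sat S φ (valCons m t)

/-- The new relation symbol cannot cut the formula π:
Th ∪ Sg ⊨ ∀x∀y(π → R(x,y)) or Th ∪ Sg ⊨ ∀x∀y(π → ¬R(x,y)). -/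
def CannotCut (L : Type) (Th : Set (FO2 L)) (Sg : Set (FO2 (L ⊕ Unit))) (π : FO2 L) : Prop :=
  (∀ (M : Type) (S : Str L M), Nonempty M → ModelsSet S Th →
      ∀ R : M → M → Prop, ModelsSet (expand S R) Sg →
        ∀ a b : M, Sat2 S π a b → R a b) ∨
  (∀ (M : Type) (S : Str L M), Nonempty M → ModelsSet S Th →
      ∀ R : M → M → Prop, ModelsSet (expand S R) Sg →
        ∀ a b : M, Sat2 S π a b → ¬ R a b)

/-- `π` is a 2-partition with respect to Th ∪ Sg: Th ∪ Sg ⊨ ∀x∀y ⋁ᵢ πᵢ and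
Th ∪ Sg ⊨ ∀x∀y ¬(πᵢ ∧ πⱼ) for i < j. -/
def IsTwoPartition (L : Type) (Th : Set (FO2 L)) (Sg : Set (FO2 (L ⊕ Unit)))
    {n : ℕ} (π : Fin (n + 1) → FO2 L) : Prop :=
  ∀ (M : Type) (S : Str L M), Nonempty M → ModelsSet S Th →
    ∀ R : M → M → Prop, ModelsSet (expand S R) Sg →
      (∀ a b : M, ∃ i, Sat2 S (π i) a b) ∧
      (∀ a b : M, ∀ i j : Fin (n + 1), i < j →
        ¬(Sat2 S (π i) a b ∧ Sat2 S (π j) a b))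

/-- The binary relation defined in `S` by an FO3-formula ρ(x,y) with free
variables among x = 0 and y = 1 (the value of z is immaterial). -/
def rel3 {L M : Type} (S : Str L M) (ρ : FO3 L) : Set (M × M) :=
  {p | Sat S ρ ![p.1, p.2, p.2]}

/-- The FO3-definable binary relations of `S`. -/
def Def3 {L M : Type} (S : Str L M) : Set (Set (M × M)) :=
  {Z | ∃ ρ : FO3 L, Free ρ ⊆ ({0, 1} : Set (Fin 3)) ∧ Z = rel3 S ρ}

/-- Converse of a binary relation. -/
def conv {M : Type} (Z : Set (M × M)) : Set (M × M) := {p | (p.2, p.1) ∈ Z}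

/-- Composition of binary relations. -/
def comp {M : Type} (Z W : Set (M × M)) : Set (M × M) :=
  {p | ∃ v, (p.1, v) ∈ Z ∧ (v, p.2) ∈ W}

/-! ### Types -/

/-- Exchange the two variables of a formula. -/
def swapVars {L : Type} : FO2 L → FO2 L
  | .eq i j => .eq (Equiv.swap 0 1 i) (Equiv.swap 0 1 j)
  | .rel r i j => .rel r (Equiv.swap 0 1 i) (Equiv.swap 0 1 j)
  | .not φ => .not (swapVars φ)
  | .and φ ψ => .and (swapVars φ) (swapVars ψ)
  | .ex i φ => .ex (Equiv.swap 0 1 i) (swapVars φ)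

theorem sat_swapVars {L M : Type} (S : Str L M) (φ : FO2 L) (v : Fin 2 → M) :
    Sat S (swapVars φ) v ↔ Sat S φ (v ∘ Equiv.swap 0 1) := by
  induction φ generalizing v with
  | eq i j => rfl
  | rel r i j => rfl
  | not φ ih => exact not_congr (ih v)
  | and φ ψ ih₁ ih₂ => exact and_congr (ih₁ v) (ih₂ v)
  | ex i φ ih =>
    refine exists_congr fun m => (ih _).trans ?_
    rw [Function.update_comp_equiv]
    simp

theorem sat2_swapVars {L M : Type} (S : Str L M) (φ : FO2 L) (a b : M) :
    Sat2 S (swapVars φ) a b ↔ Sat2 S φ b a := by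
  have h : (![a, b] ∘ Equiv.swap (0 : Fin 2) 1) = ![b, a] := by
    ext i; fin_cases i <;> simp
  rw [Sat2, sat_swapVars, h, Sat2]

theorem update_pair_zero {M : Type} (a b m : M) :
    Function.update ![a, b] 0 m = ![m, b] := by
  ext i; fin_cases i <;> simp

theorem update_pair_one {M : Type} (a b m : M) :
    Function.update ![a, b] 1 m = ![a, m] := by
  ext i; fin_cases i <;> simp

theorem sat2_iff_of_type2_eq {L M : Type} {S : Str L M} {a b c d : M}
    (h : Type2 S a b = Type2 S c d) (φ : FO2 L) : Sat2 S φ a b ↔ Sat2 S φ c d :=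
  Set.ext_iff.mp h φ

theorem type2_swap {L M : Type} {S : Str L M} {a b c d : M}
    (h : Type2 S a b = Type2 S c d) : Type2 S b a = Type2 S d c := by
  ext φ
  have := sat2_iff_of_type2_eq h (swapVars φ)
  rwa [sat2_swapVars, sat2_swapVars] at this

theorem type2_fst {L M : Type} {S : Str L M} {a b c d : M}
    (h : Type2 S a b = Type2 S c d) : Type2 S a a = Type2 S c c := by
  ext φ
  simpa [Type2, Sat2, Sat, update_pair_one] using
    sat2_iff_of_type2_eq h (.ex 1 (.and (.eq 0 1) φ))

theorem type2_snd {L M : Type} {S : Str L M} {a b c d : M}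
    (h : Type2 S a b = Type2 S c d) : Type2 S b b = Type2 S d d :=
  type2_fst (type2_swap h)

theorem type2_eq_iff {L M : Type} {S : Str L M} {a b c d : M}
    (h : Type2 S a b = Type2 S c d) : a = b ↔ c = d := by
  simpa [Sat2, Sat] using sat2_iff_of_type2_eq h (.eq 0 1)

theorem type2_rel_iff {L M : Type} {S : Str L M} {a b c d : M}
    (h : Type2 S a b = Type2 S c d) (r : L) : S r a b ↔ S r c d := by
  simpa [Sat2, Sat] using sat2_iff_of_type2_eq h (.rel r 0 1)

theorem exists_sat2_not_sat2 {L M : Type} {S : Str L M} {a b c d : M}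
    (h : Type2 S a b ≠ Type2 S c d) : ∃ φ : FO2 L, Sat2 S φ a b ∧ ¬ Sat2 S φ c d := by
  by_contra! H
  refine h (Set.ext fun φ => ⟨H φ, fun hc => ?_⟩)
  by_contra hn
  exact H (.not φ) hn hc

/-- Finite structures are 2-homogeneous. -/
theorem isHomog2_of_finite {L M : Type} [Finite M] (S : Str L M) : IsHomog2 S := by
  intro a b c hab
  by_contra! H
  have key : ∀ s : Set M, s.Finite →
      ∃ φ : FO2 L, Sat2 S φ a c ∧ ∀ d ∈ s, ¬ Sat2 S φ b d := by
    intro s hs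
    induction s, hs using Set.Finite.induction_on with
    | empty => exact ⟨.eq 0 0, rfl, by simp⟩
    | @insert d s _ _ ih =>
      obtain ⟨φ, hφ, hs⟩ := ih
      obtain ⟨ψ, hψ, hd⟩ := exists_sat2_not_sat2 (H d)
      refine ⟨.and φ ψ, ⟨hφ, hψ⟩, ?_⟩
      rintro e (rfl | he) ⟨h₁, h₂⟩
      · exact hd h₂
      · exact hs e he h₁
  obtain ⟨φ, hφ, hn⟩ := key Set.univ Set.finite_univ
  have := sat2_iff_of_type2_eq hab (.ex 1 φ)
  simp only [Sat2, Sat, update_pair_one] at this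
  obtain ⟨d, hd⟩ := this.mp ⟨c, hφ⟩
  exact hn d trivial hd

/-! ### Preservation of types by symmetric 2-isomorphisms -/

theorem IsTwoIso.sat_iff {L M N : Type} {S : Str L M} {T : Str L N}
    {i1 : M → N → Prop} {i2 : M → M → N → N → Prop} (h : IsTwoIso S T i1 i2)
    (symm : ∀ a b a' b', i2 a b a' b' → i2 b a b' a') (φ : FO2 L) {a b : M} {a' b' : N}
    (hab : i2 a b a' b') : Sat S φ ![a, b] ↔ Sat T φ ![a', b'] := by
  induction φ generalizing a b a' b' with
  | eq i j =>
    have h₁ := h.eq_iff _ _ _ _ hab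
    have h₂ := h.eq_iff _ _ _ _ (symm _ _ _ _ hab)
    fin_cases i <;> fin_cases j <;> simp [Sat, h₁, h₂]
  | rel r i j =>
    obtain ⟨_, _, _, _⟩ := h.rel_iff2 _ _ _ _ hab r
    fin_cases i <;> fin_cases j <;> simpa [Sat]
  | not φ ih => exact not_congr (ih hab)
  | and φ ψ ih₁ ih₂ => exact and_congr (ih₁ hab) (ih₂ hab)
  | ex i φ ih =>
    obtain ⟨ha, hb⟩ := h.restrict _ _ _ _ hab
    fin_cases i
    · simp only [Sat, Fin.zero_eta, update_pair_zero]
      constructor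
      · rintro ⟨m, hm⟩
        obtain ⟨m', hm'⟩ := h.forth2 _ _ hb m
        exact ⟨m', (ih (symm _ _ _ _ hm')).mp hm⟩
      · rintro ⟨m', hm⟩
        obtain ⟨m, hm'⟩ := h.back2 _ _ hb m'
        exact ⟨m, (ih (symm _ _ _ _ hm')).mpr hm⟩
    · simp only [Sat, Fin.mk_one, update_pair_one]
      constructor
      · rintro ⟨m, hm⟩
        obtain ⟨m', hm'⟩ := h.forth2 _ _ ha m
        exact ⟨m', (ih hm').mp hm⟩
      · rintro ⟨m', hm⟩
        obtain ⟨m, hm'⟩ := h.back2 _ _ ha m'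
        exact ⟨m, (ih hm').mpr hm⟩

theorem IsTwoIso.sat2_iff {L M N : Type} {S : Str L M} {T : Str L N}
    {i1 : M → N → Prop} {i2 : M → M → N → N → Prop} (h : IsTwoIso S T i1 i2)
    (symm : ∀ a b a' b', i2 a b a' b' → i2 b a b' a') (φ : FO2 L) {a : M} {a' : N}
    (ha : i1 a a') : Sat2 S φ a a ↔ Sat2 T φ a' a' := by
  obtain ⟨b', hb⟩ := h.forth2 _ _ ha a
  obtain rfl := (h.eq_iff _ _ _ _ hb).mp rfl
  exact h.sat_iff symm φ hb

/-! ### Structures pulled back along a colouring by pairs -/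

/-- The structure on `N` in which a pair satisfies what its colour, a pair of elements of `S`,
satisfies. -/
def colourStr {L M N : Type} (S : Str L M) (col : N → N → M × M) : Str L N :=
  fun r x y => S r (col x y).1 (col x y).2

/-- A colouring of the pairs of `N` by pairs of elements of `S` that makes `N` a
2-isomorphic copy of `S`. -/
structure IsColouring {L M N : Type} (S : Str L M) (col : N → N → M × M) : Prop where
  swap : ∀ x y, col y x = (col x y).swap
  eq_iff : ∀ x y, (col x y).1 = (col x y).2 ↔ x = y
  fst_type : ∀ x y, Type2 S (col x y).1 (col x y).1 = Type2 S (col x x).1 (col x x).1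
  onto : ∀ a, ∃ x, Type2 S a a = Type2 S (col x x).1 (col x x).1
  extend : ∀ a b x, Type2 S a a = Type2 S (col x x).1 (col x x).1 →
    ∃ y, Type2 S a b = Type2 S (col x y).1 (col x y).2

theorem IsColouring.isTwoIso {L M N : Type} {S : Str L M} {col : N → N → M × M}
    (hS : IsHomog2 S) (h : IsColouring S col) :
    IsTwoIso S (colourStr S col)
      (fun a x => Type2 S a a = Type2 S (col x x).1 (col x x).1)
      (fun a b x y => Type2 S a b = Type2 S (col x y).1 (col x y).2) := by
  have hdiag : ∀ x, (col x x).2 = (col x x).1 := fun x => ((h.eq_iff x x).mpr rfl).symm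
  have hone : ∀ a x, Type2 S a a = Type2 S (col x x).1 (col x x).1 → ∀ r,
      S r a a ↔ colourStr S col r x x := by
    intro a x hx r
    rw [colourStr, hdiag]
    exact type2_rel_iff hx r
  have hswap : ∀ a b x y, Type2 S a b = Type2 S (col x y).1 (col x y).2 →
      Type2 S b a = Type2 S (col y x).1 (col y x).2 := by
    intro a b x y hx
    rw [h.swap x y]
    exact type2_swap hx
  have hfst : ∀ a b x y, Type2 S a b = Type2 S (col x y).1 (col x y).2 →
      Type2 S a a = Type2 S (col x x).1 (col x x).1 :=
    fun a b x y hx => (type2_fst hx).trans (h.fst_type x y)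
  refine ⟨?_, ?_, hone, ?_, h.onto, fun x => ⟨_, rfl⟩, ?_, ?_⟩
  · exact fun a b x y hx => (type2_eq_iff hx).trans (h.eq_iff x y)
  · intro a b x y hx r
    exact ⟨hone _ _ (hfst _ _ _ _ hx) r, type2_rel_iff hx r,
      type2_rel_iff (hswap _ _ _ _ hx) r, hone _ _ (hfst _ _ _ _ (hswap _ _ _ _ hx)) r⟩
  · exact fun a b x y hx => ⟨hfst _ _ _ _ hx, hfst _ _ _ _ (hswap _ _ _ _ hx)⟩
  · exact fun a x hx b => h.extend a b x hx
  · intro a x hx y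
    obtain ⟨b, hb⟩ := hS _ _ (col x y).2 ((h.fst_type x y).trans hx.symm)
    exact ⟨b, hb.symm⟩

theorem IsColouring.isTransitive {L M N : Type} {S : Str L M} {col : N → N → M × M}
    (hS : IsHomog2 S) (h : IsColouring S col)
    (htrans : ∀ x y, Type2 S (col x x).1 (col x x).1 = Type2 S (col y y).1 (col y y).1 →
      ∃ f : N ≃ N, (∀ u v, col (f u) (f v) = col u v) ∧ f x = y) :
    IsTransitive (colourStr S col) := by
  intro x y hxy
  have hiso := h.isTwoIso hS
  have symm : ∀ a b x y, Type2 S a b = Type2 S (col x y).1 (col x y).2 →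
      Type2 S b a = Type2 S (col y x).1 (col y x).2 := by
    intro a b x y hx
    rw [h.swap x y]
    exact type2_swap hx
  obtain ⟨f, hf, hfx⟩ := htrans x y (Set.ext fun φ =>
    (hiso.sat2_iff symm φ (a' := x) rfl).trans <| (sat2_iff_of_type2_eq hxy φ).trans
      (hiso.sat2_iff symm φ (a' := y) rfl).symm)
  exact ⟨f, fun r u v => by simp only [colourStr, hf], hfx⟩

/-! ### The colouring -/

/-- There is a finite group in which every non-zero element is either positive or negative, with
enough positive elements to enumerate a given finite type. -/
theorem exists_group_enumeration (X : Type) [Finite X] [Nonempty X] :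
    ∃ (G : Type) (_ : AddCommGroup G) (_ : Finite G) (pos : G → Prop) (enc : G → X),
      ¬ pos 0 ∧ (∀ g, g ≠ 0 → (pos (-g) ↔ ¬ pos g)) ∧ ∀ x, ∃ g, pos g ∧ enc g = x := by
  obtain ⟨m, ⟨e⟩⟩ := Finite.exists_equiv_fin X
  refine ⟨ZMod (2 * m + 1), inferInstance, inferInstance, fun g => 0 < g.val ∧ g.val ≤ m,
    fun g => if h : g.val - 1 < m then e.symm ⟨g.val - 1, h⟩ else Classical.arbitrary X,
    by simp, ?_, ?_⟩
  · intro g hg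
    have h0 : g.val ≠ 0 := fun h => hg ((ZMod.val_eq_zero g).mp h)
    have hlt := ZMod.val_lt g
    simp only [ZMod.neg_val, if_neg hg]
    omega
  · intro x
    have hx := (e x).isLt
    have hval : ((((e x : ℕ) + 1 : ℕ) : ZMod (2 * m + 1))).val = (e x : ℕ) + 1 :=
      ZMod.val_cast_of_lt (by omega)
    refine ⟨(((e x : ℕ) + 1 : ℕ) : ZMod (2 * m + 1)), ?_, ?_⟩
    · simp only [hval]; omega
    · simp only [hval]
      simp


/-- A class of the partition `cls` with at most one element. -/
def IsKing {M P : Type} (cls : M → P) (p : P) : Prop :=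
  ∀ a b, cls a = p → cls b = p → a = b

/-- The copy of a class of `cls` is `{0}` if the class is a king, and `G` otherwise. -/
abbrev Blowup {M P : Type} (cls : M → P) (G : Type) [AddCommGroup G] : Type :=
  {x : P × G // IsKing cls x.1 → x.2 = 0}

section Admissible

variable {M P G : Type} (cls : M → P)

/-- The pairs of distinct elements that may colour a pair from the classes `p` and `q`. -/
def Admissible (p q : P) (c : M × M) : Prop :=
  cls c.1 = p ∧ cls c.2 = q ∧ c.1 ≠ c.2

open Classical in
/-- The enumeration `enc`, redirected to admissible pairs. -/
noncomputable def admEnc (enc : G → M × M) (p q : P) (g : G) : M × M :=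
  if Admissible cls p q (enc g) then enc g
  else if h : ∃ c, Admissible cls p q c then h.choose else enc g

theorem admissible_admEnc (enc : G → M × M) {p q : P} (h : ∃ c, Admissible cls p q c) (g : G) :
    Admissible cls p q (admEnc cls enc p q g) := by
  unfold admEnc
  split_ifs with h'
  · exact h'
  · exact h.choose_spec

end Admissible

section Blowup

variable {M P G : Type} [AddCommGroup G] (cls : M → P)

open Classical in
/-- Translation by `s` on all copies of `G`. -/
noncomputable def shiftFun (s : G) (x : Blowup cls G) : Blowup cls G :=
  ⟨(x.1.1, if IsKing cls x.1.1 then 0 else x.1.2 + s), fun h => if_pos h⟩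

theorem shiftFun_shiftFun_neg {s t : G} (hst : s + t = 0) (x : Blowup cls G) :
    shiftFun cls t (shiftFun cls s x) = x := by
  obtain ⟨⟨p, g⟩, hx⟩ := x
  by_cases h : IsKing cls p
  · obtain rfl : g = 0 := hx h
    simp [shiftFun, h]
  · simp [shiftFun, h, add_assoc, hst]

/-- Translation by `s` on all copies of `G`, as a permutation. -/
noncomputable def shift (s : G) : Blowup cls G ≃ Blowup cls G where
  toFun := shiftFun cls s
  invFun := shiftFun cls (-s)
  left_inv := shiftFun_shiftFun_neg cls (add_neg_cancel s)
  right_inv := shiftFun_shiftFun_neg cls (neg_add_cancel s)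

open Classical in
/-- The difference of two elements, taken to be zero when a king is involved. -/
noncomputable def diff (x y : Blowup cls G) : G :=
  if IsKing cls x.1.1 ∨ IsKing cls y.1.1 then 0 else y.1.2 - x.1.2

theorem diff_swap (x y : Blowup cls G) : diff cls y x = - diff cls x y := by
  by_cases h : IsKing cls x.1.1 <;> by_cases h' : IsKing cls y.1.1 <;> simp [diff, h, h']

theorem diff_shift (s : G) (x y : Blowup cls G) :
    diff cls (shift cls s x) (shift cls s y) = diff cls x y := by
  by_cases h : IsKing cls x.1.1 <;> by_cases h' : IsKing cls y.1.1 <;>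
    simp [diff, shift, shiftFun, h, h']

theorem exists_shift_eq {x y : Blowup cls G} (h : x.1.1 = y.1.1) :
    ∃ s : G, shift cls s x = y := by
  obtain ⟨⟨p, g⟩, hx⟩ := x
  obtain ⟨⟨q, k⟩, hy⟩ := y
  obtain rfl : p = q := h
  refine ⟨k - g, ?_⟩
  by_cases hk : IsKing cls p
  · obtain rfl : k = 0 := hy hk
    simp [shift, shiftFun, hk]
  · simp [shift, shiftFun, hk]

theorem eq_of_diff_eq_zero {x y : Blowup cls G} (h : x.1.1 = y.1.1) (hd : diff cls x y = 0) :
    x = y := by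
  obtain ⟨⟨p, g⟩, hx⟩ := x
  obtain ⟨⟨q, k⟩, hy⟩ := y
  obtain rfl : p = q := h
  by_cases hk : IsKing cls p
  · obtain rfl : k = 0 := hy hk
    obtain rfl : g = 0 := hx hk
    rfl
  · have : k = g := by simpa [diff, hk, sub_eq_zero] using hd
    simp [this]

theorem exists_admissible (hcls : Function.Surjective cls) {x y : Blowup cls G} (h : x ≠ y) :
    ∃ c, Admissible cls x.1.1 y.1.1 c := by
  by_cases hp : x.1.1 = y.1.1
  · have hk : ¬ IsKing cls x.1.1 := by
      intro hk
      exact h (eq_of_diff_eq_zero cls hp (if_pos (Or.inl hk)))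
    simp only [IsKing, not_forall] at hk
    obtain ⟨a, b, ha, hb, hab⟩ := hk
    exact ⟨(a, b), ha, hb.trans hp, hab⟩
  · obtain ⟨a, ha⟩ := hcls x.1.1
    obtain ⟨b, hb⟩ := hcls y.1.1
    exact ⟨(a, b), ha, hb, fun hab => hp (by rw [← ha, ← hb]; exact congrArg cls hab)⟩

variable [LinearOrder P] (pos : G → Prop) (enc : G → M × M)

/-- The pair `(x, y)` is oriented forwards. -/
def Forward (x y : Blowup cls G) : Prop :=
  pos (diff cls x y) ∨ (diff cls x y = 0 ∧ x.1.1 < y.1.1)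

theorem forward_swap (h0 : ¬ pos 0) (hneg : ∀ g, g ≠ 0 → (pos (-g) ↔ ¬ pos g))
    {x y : Blowup cls G} (h : x ≠ y) : Forward cls pos y x ↔ ¬ Forward cls pos x y := by
  unfold Forward
  rw [diff_swap]
  by_cases hd : diff cls x y = 0
  · have : x.1.1 ≠ y.1.1 := fun hp => h (eq_of_diff_eq_zero cls hp hd)
    simp only [hd, neg_zero, h0, true_and, false_or, not_lt]
    exact ⟨le_of_lt, fun hle => lt_of_le_of_ne hle this.symm⟩
  · simp [hd, hneg _ hd]

open Classical in
/-- The colour of a pair: a pair of elements of the corresponding classes, invariant under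
translations. -/
noncomputable def colour (rep : P → M) (x y : Blowup cls G) : M × M :=
  if x = y then (rep x.1.1, rep x.1.1)
  else if Forward cls pos x y then admEnc cls enc x.1.1 y.1.1 (diff cls x y)
  else (admEnc cls enc y.1.1 x.1.1 (diff cls y x)).swap

variable (rep : P → M)

theorem colour_self (x : Blowup cls G) :
    colour cls pos enc rep x x = (rep x.1.1, rep x.1.1) :=
  if_pos rfl

theorem colour_shift (s : G) (x y : Blowup cls G) :
    colour cls pos enc rep (shift cls s x) (shift cls s y) = colour cls pos enc rep x y := by
  have hfst : ∀ z : Blowup cls G, (shift cls s z).1.1 = z.1.1 := fun _ => rfl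
  have hforward : Forward cls pos (shift cls s x) (shift cls s y) ↔ Forward cls pos x y := by
    simp only [Forward, diff_shift, hfst]
  by_cases h : x = y
  · subst h
    simp only [colour_self, hfst]
  · have h' : shift cls s x ≠ shift cls s y := (shift cls s).injective.ne h
    by_cases hf : Forward cls pos x y <;> simp [colour, h, h', hforward, hf, hfst, diff_shift]

theorem colour_swap (h0 : ¬ pos 0) (hneg : ∀ g, g ≠ 0 → (pos (-g) ↔ ¬ pos g))
    (x y : Blowup cls G) :
    colour cls pos enc rep y x = (colour cls pos enc rep x y).swap := by
  by_cases h : x = y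
  · subst h
    simp [colour_self]
  · by_cases hf : Forward cls pos x y <;>
      simp [colour, h, Ne.symm h, forward_swap cls pos h0 hneg h, hf]

theorem admissible_colour (hcls : Function.Surjective cls) {x y : Blowup cls G} (h : x ≠ y) :
    Admissible cls x.1.1 y.1.1 (colour cls pos enc rep x y) := by
  unfold colour
  rw [if_neg h]
  split_ifs
  · exact admissible_admEnc cls enc (exists_admissible cls hcls h) _
  · obtain ⟨h₁, h₂, h₃⟩ := admissible_admEnc cls enc (exists_admissible cls hcls h.symm)
      (diff cls y x)
    exact ⟨h₂, h₁, h₃.symm⟩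

end Blowup

/-- If the class of `a` or the class of `b` is a singleton, the classes determine the 2-type. -/
theorem type2_eq_of_isKing {L M P : Type} {S : Str L M} (hS : IsHomog2 S) {cls : M → P}
    (ht : ∀ a b, cls a = cls b ↔ Type2 S a a = Type2 S b b) {a b c d : M}
    (hac : cls a = cls c) (hbd : cls b = cls d)
    (hk : IsKing cls (cls a) ∨ IsKing cls (cls b)) : Type2 S a b = Type2 S c d := by
  have aux : ∀ a b c d, cls a = cls c → cls b = cls d → IsKing cls (cls b) →
      Type2 S a b = Type2 S c d := by
    intro a b c d hac hbd hk
    obtain ⟨e, he⟩ := hS a c b ((ht _ _).mp hac)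
    rw [hk d e hbd.symm ((ht _ _).mpr (type2_snd he.symm))]
    exact he
  rcases hk with hk | hk
  · exact type2_swap (aux _ _ _ _ hbd hac hk)
  · exact aux _ _ _ _ hac hbd hk

theorem isColouring_colour {L M P G : Type} [AddCommGroup G] [LinearOrder P] {S : Str L M}
    (hS : IsHomog2 S) {cls : M → P}
    (ht : ∀ a b, cls a = cls b ↔ Type2 S a a = Type2 S b b) {pos : G → Prop}
    {enc : G → M × M} (h0 : ¬ pos 0) (hneg : ∀ g, g ≠ 0 → (pos (-g) ↔ ¬ pos g))
    (henc : ∀ c, ∃ g, pos g ∧ enc g = c) {rep : P → M} (hrep : ∀ p, cls (rep p) = p) :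
    IsColouring S (colour (G := G) cls pos enc rep) := by
  have hcls : Function.Surjective cls := fun p => ⟨_, hrep p⟩
  refine ⟨colour_swap cls pos enc rep h0 hneg, ?_, ?_, ?_, ?_⟩
  · intro x y
    refine ⟨fun h => ?_, ?_⟩
    · by_contra hxy
      exact (admissible_colour cls pos enc rep hcls hxy).2.2 h
    · rintro rfl
      rw [colour_self]
  · intro x y
    by_cases hxy : x = y
    · subst hxy
      rfl
    · rw [← ht, (admissible_colour cls pos enc rep hcls hxy).1, colour_self, hrep]
  · intro a
    refine ⟨⟨(cls a, 0), fun _ => rfl⟩, ?_⟩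
    rw [← ht, colour_self, hrep]
  · intro a b x hx
    by_cases hab : a = b
    · subst hab
      refine ⟨x, ?_⟩
      rw [colour_self] at hx ⊢
      exact hx
    rw [← ht, colour_self, hrep] at hx
    by_cases hk : IsKing cls (cls a) ∨ IsKing cls (cls b)
    · have hne : x ≠ ⟨(cls b, 0), fun _ => rfl⟩ := by
        rintro rfl
        have hk' : IsKing cls (cls b) := by
          rcases hk with hk | hk
          · rwa [hx] at hk
          · exact hk
        exact hab (hk' a b hx rfl)
      obtain ⟨h₁, h₂, -⟩ := admissible_colour cls pos enc rep hcls hne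
      exact ⟨_, type2_eq_of_isKing hS ht (hx.trans h₁.symm) h₂.symm hk⟩
    · obtain ⟨g, hg, hgc⟩ := henc (a, b)
      have hk' := not_or.mp hk
      let y : Blowup cls G := ⟨(cls b, x.1.2 + g), fun h => absurd h hk'.2⟩
      have hd : diff cls x y = g := by simp [diff, y, ← hx, hk'.1, hk'.2]
      have hne : x ≠ y := by
        intro hxy
        have h2 : x.1.2 = x.1.2 + g := congrArg (fun z => z.1.2) hxy
        rw [left_eq_add] at h2
        exact h0 (h2 ▸ hg)
      have hadm : Admissible cls x.1.1 y.1.1 (enc g) := by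
        rw [hgc]
        exact ⟨hx, rfl, hab⟩
      have hf : Forward cls pos x y := Or.inl (hd.symm ▸ hg)
      refine ⟨y, ?_⟩
      rw [colour, if_neg hne, if_pos hf, hd, admEnc, if_pos hadm, hgc]

/-- Every finite binary model is 2-isomorphic to a finite
transitive model. -/
theorem stmt2 (L M : Type) [Finite M] [Nonempty M] (S : Str L M) :
    ∃ (N : Type) (T : Str L N),
      Finite N ∧ Nonempty N ∧ IsTransitive T ∧ TwoIsomorphic S T := by
  have hS := isHomog2_of_finite S
  obtain ⟨k, ⟨e⟩⟩ := Finite.exists_equiv_fin (Set.range fun a => Type2 S a a)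
  obtain ⟨G, _, _, pos, enc, h0, hneg, henc⟩ := exists_group_enumeration (M × M)
  let cls : M → Fin k := fun a => e ⟨Type2 S a a, a, rfl⟩
  have ht : ∀ a b, cls a = cls b ↔ Type2 S a a = Type2 S b b :=
    fun a b => e.injective.eq_iff.trans Subtype.ext_iff
  have hsurj : Function.Surjective cls := by
    intro p
    obtain ⟨a, ha⟩ := (e.symm p).2
    exact ⟨a, by simp only [cls, ha, Subtype.coe_eta, Equiv.apply_symm_apply]⟩
  choose rep hrep using hsurj
  have hcol := isColouring_colour hS ht h0 hneg henc hrep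
  refine ⟨Blowup cls G, _, inferInstance, ?_, hcol.isTransitive hS ?_, _, _, hcol.isTwoIso hS⟩
  · exact ⟨⟨(cls (Classical.arbitrary M), 0), fun _ => rfl⟩⟩
  · intro x y hxy
    rw [← ht, colour_self, colour_self, hrep, hrep] at hxy
    obtain ⟨s, hs⟩ := exists_shift_eq cls hxy
    exact ⟨shift cls s, colour_shift cls pos enc rep s, hs⟩

end AN
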